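/- There is a constant A > 0 depending only on π₁ and π₂ such that for any positive integers i and j, any even positive integer L, and any nonzero real number a, |∫_{π/2^i}^{π/2^{i−1}} D(λ)·H_{j,L}(λ)·Π(λ)·e^{iaλ} dλ| ≤ 2^j·c_L·A/|a|. -/

import Mathlib

noncomputable section

def Dfn (l : ℝ) : ℝ := (2 / Real.pi) * (Real.sin (l / 2)) ^ 2 / l ^ 2

def Pifn (p1 p2 : ℝ) (l : ℝ) : ℂ :=
  (((1 - p1) * (1 - p2) : ℝ) : ℂ) /
    ((1 - (p1 : ℂ) * Complex.exp (Complex.I * l)) *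
      (1 - (p2 : ℂ) * Complex.exp (-(Complex.I * l))))

def HLfn (L : ℕ) (l : ℝ) : ℝ :=
  2 * (Real.sin (l / 2)) ^ L *
    ∑ p ∈ Finset.range (L / 2), ((L / 2 - 1 + p).choose p : ℝ) * (Real.cos (l / 2)) ^ (2 * p)

def GLfn (L : ℕ) (l : ℝ) : ℝ := HLfn L (l - Real.pi)

def HjL (j L : ℕ) (l : ℝ) : ℝ :=
  HLfn L (2 ^ (j - 1) * l) * ∏ i ∈ Finset.range (j - 1), GLfn L (2 ^ i * l)

def cL (L : ℕ) : ℝ := ((L - 2).choose (L / 2 - 1) : ℝ) * ((L : ℝ) - 1) / 2 ^ (L - 2)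

def Lam (j : ℤ) : Set ℝ :=
  Set.Ico (-((2 : ℝ) ^ (j + 1) * Real.pi)) (-((2 : ℝ) ^ j * Real.pi)) ∪
    Set.Ioc ((2 : ℝ) ^ j * Real.pi) ((2 : ℝ) ^ (j + 1) * Real.pi)

def tauJ (J : ℕ) : ℝ := ((2 : ℝ) ^ (J + 1))⁻¹

def fJ (R θv : ℕ → ℝ) (J : ℕ) (l : ℝ) : ℂ :=
  ∑ i ∈ Finset.Icc 1 (J + 1),
    ((R i : ℝ) : ℂ) * Complex.exp (-(Complex.I * (θv i : ℝ) * l)) *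
      (Lam ((J : ℤ) - i + 1)).indicator (fun _ => (1 : ℂ)) l

def rhoBar (R θv : ℕ → ℝ) (p1 p2 : ℝ) (j L J : ℕ) (th : ℝ) : ℂ :=
  ∫ l : ℝ, ((Dfn l : ℝ) : ℂ) * ((HjL j L l : ℝ) : ℂ) * Pifn p1 p2 l *
    Complex.exp (Complex.I * ((tauJ J)⁻¹ * th) * l) * fJ R θv J ((tauJ J)⁻¹ * l)

def psiLP (s : ℝ) : ℝ :=
  if s = 0 then 1
  else 2 * (Real.sin (2 * Real.pi * s) / (2 * Real.pi * s)) - Real.sin (Real.pi * s) / (Real.pi * s)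

def psiLPj (j : ℤ) (t : ℝ) : ℝ := (2 : ℝ) ^ ((j : ℝ) / 2) * psiLP ((2 : ℝ) ^ j * t)

open intervalIntegral in
/-- Non-stationary-phase bound obtained by one integration by parts. -/
theorem norm_integral_mul_cexp_le {F F' : ℝ → ℂ} {b c a : ℝ} (hbc : b ≤ c) (ha : a ≠ 0)
    (hF : ∀ x, HasDerivAt F (F' x) x) (hF' : Continuous F') :
    ‖∫ x in b..c, F x * Complex.exp (Complex.I * a * x)‖ ≤
      (‖F b‖ + ‖F c‖ + ∫ x in b..c, ‖F' x‖) / |a| := by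
  have haC : (Complex.I * a) ≠ 0 := by simp [ha]
  have hn : ∀ x : ℝ, ‖Complex.exp (Complex.I * a * x) / (Complex.I * a)‖ = 1 / |a| := by
    intro x
    have : Complex.I * a * x = ((a * x : ℝ) : ℂ) * Complex.I := by push_cast; ring
    rw [norm_div, this, Complex.norm_exp_ofReal_mul_I]
    simp
  have hv : ∀ x : ℝ, HasDerivAt
      (fun x : ℝ => Complex.exp (Complex.I * a * x) / (Complex.I * a))
      (Complex.exp (Complex.I * a * x)) x := by
    intro x
    have h1 : HasDerivAt (fun x : ℝ => Complex.I * a * (x : ℂ)) (Complex.I * a) x := by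
      simpa using (Complex.ofRealCLM.hasDerivAt (x := x)).const_mul (Complex.I * a)
    convert! h1.cexp.div_const (Complex.I * a) using 1
    rw [mul_div_cancel_right₀ _ haC]
  have hc : Continuous fun x : ℝ => Complex.exp (Complex.I * a * x) := by fun_prop
  rw [integral_mul_deriv_eq_deriv_mul (fun x _ => hF x) (fun x _ => hv x)
    (hF'.intervalIntegrable _ _) (hc.intervalIntegrable _ _)]
  have h3 : ‖∫ x in b..c, F' x * (Complex.exp (Complex.I * a * x) / (Complex.I * a))‖ ≤
      (∫ x in b..c, ‖F' x‖) / |a| := by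
    refine (norm_integral_le_integral_norm hbc).trans_eq ?_
    simp_rw [norm_mul, hn]
    rw [integral_mul_const, mul_one_div]
  calc _ ≤ ‖F c * (Complex.exp (Complex.I * a * c) / (Complex.I * a))‖
        + ‖F b * (Complex.exp (Complex.I * a * b) / (Complex.I * a))‖
        + ‖∫ x in b..c, F' x * (Complex.exp (Complex.I * a * x) / (Complex.I * a))‖ :=
        (norm_sub_le _ _).trans (by gcongr; exact norm_sub_le _ _)
    _ ≤ ‖F c‖ * (1 / |a|) + ‖F b‖ * (1 / |a|) + (∫ x in b..c, ‖F' x‖) / |a| := by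
        rw [norm_mul, norm_mul, hn, hn]; gcongr
    _ = _ := by ring

/-- `(1 - x) P'(x) - (n + 1) P(x)` telescopes for the partial sums `P` of `(1 - x)^{-(n + 1)}`. -/
theorem sum_choose_mul_pow_telescope (n N : ℕ) (x : ℝ) :
    (1 - x) * ∑ p ∈ Finset.range (N + 1), ((n + p).choose p : ℝ) * (p * x ^ (p - 1)) -
      (n + 1) * ∑ p ∈ Finset.range (N + 1), ((n + p).choose p : ℝ) * x ^ p =
      -((n + N + 1) * ((n + N).choose N : ℝ) * x ^ N) := by
  induction N with
  | zero => simp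
  | succ N ih =>
    rw [Finset.sum_range_succ, Finset.sum_range_succ (n := N + 1)]
    have h : ((N : ℝ) + 1) * ((n + (N + 1)).choose (N + 1) : ℝ) =
        (n + N + 1) * ((n + N).choose N : ℝ) := by
      have := Nat.add_one_mul_choose_eq (n + N) N
      have h2 : ((n + N + 1 : ℕ) : ℝ) * ((n + N).choose N : ℝ) =
        ((n + N + 1).choose (N + 1) : ℝ) * ((N + 1 : ℕ) : ℝ) := by exact_mod_cast this
      push_cast at h2
      rw [← add_assoc]; linarith
    simp only [Nat.add_sub_cancel]
    push_cast
    linear_combination ih + x ^ N * h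

theorem hasDerivAt_HLfn {L : ℕ} (hL : Even L) (hpos : 0 < L) (l : ℝ) :
    HasDerivAt (HLfn L) (cL L * Real.sin l ^ (L - 1)) l := by
  obtain ⟨m, rfl⟩ := hL
  obtain ⟨n, rfl⟩ : ∃ n, m = n + 1 := ⟨m - 1, by omega⟩
  have e1 : (n + 1 + (n + 1)) / 2 = n + 1 := by omega
  have e2 : n + 1 + (n + 1) - 2 = 2 * n := by omega
  have e3 : n + 1 + (n + 1) - 1 = 2 * n + 1 := by omega
  have hfun : HLfn (n + 1 + (n + 1)) = fun l => 2 * ((1 - Real.cos (l / 2) ^ 2) ^ (n + 1) *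
      ∑ p ∈ Finset.range (n + 1), ((n + p).choose p : ℝ) * (Real.cos (l / 2) ^ 2) ^ p) := by
    funext l
    simp only [HLfn, e1, Nat.add_sub_cancel]
    rw [← Real.sin_sq, ← pow_mul, mul_assoc, two_mul (n + 1)]
    simp_rw [← pow_mul]
  have hc : HasDerivAt (fun l : ℝ => Real.cos (l / 2) ^ 2)
      (-(Real.cos (l / 2) * Real.sin (l / 2))) l := by
    convert! (((hasDerivAt_id l).div_const 2).cos).pow 2 using 1
    simp; ring
  have hP : ∀ x : ℝ, HasDerivAt (fun x : ℝ => 2 * ((1 - x) ^ (n + 1) *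
      ∑ p ∈ Finset.range (n + 1), ((n + p).choose p : ℝ) * x ^ p))
      (-(2 * (2 * n + 1) * ((2 * n).choose n : ℝ) * x ^ n * (1 - x) ^ n)) x := by
    intro x
    have h1 : HasDerivAt (fun x : ℝ => ∑ p ∈ Finset.range (n + 1), ((n + p).choose p : ℝ) * x ^ p)
        (∑ p ∈ Finset.range (n + 1), ((n + p).choose p : ℝ) * (p * x ^ (p - 1))) x :=
      HasDerivAt.fun_sum fun p _ => (hasDerivAt_pow p x).const_mul _
    have h2 : HasDerivAt (fun x : ℝ => (1 - x) ^ (n + 1)) (-((n + 1) * (1 - x) ^ n)) x := by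
      convert! ((hasDerivAt_id x).const_sub 1).pow (n + 1) using 1
      simp
    convert! (h2.mul h1).const_mul 2 using 1
    have h3 := sum_choose_mul_pow_telescope n n x
    rw [← two_mul n] at h3
    rw [pow_succ]
    linear_combination (-2 * (1 - x) ^ n) * h3
  rw [hfun]
  convert! (hP (Real.cos (l / 2) ^ 2)).comp l hc using 1
  have hs : Real.sin l = 2 * Real.sin (l / 2) * Real.cos (l / 2) := by
    rw [← Real.sin_two_mul]; ring_nf
  simp only [cL, e1, e2, e3, Nat.add_sub_cancel]
  rw [← Real.sin_sq, hs]
  push_cast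
  field_simp
  ring

theorem one_le_cL {L : ℕ} (hL : Even L) (hpos : 0 < L) : 1 ≤ cL L := by
  obtain ⟨m, rfl⟩ := hL
  obtain ⟨n, rfl⟩ : ∃ n, m = n + 1 := ⟨m - 1, by omega⟩
  have e1 : (n + 1 + (n + 1)) / 2 = n + 1 := by omega
  have e2 : n + 1 + (n + 1) - 2 = 2 * n := by omega
  simp only [cL, e1, e2, Nat.add_sub_cancel]
  rw [le_div_iff₀ (by positivity), one_mul, pow_mul]
  have h := Nat.four_pow_le_two_mul_add_one_mul_central_binom n
  have h' : (4 : ℝ) ^ n ≤ (2 * n + 1) * ((2 * n).choose n : ℝ) := by exact_mod_cast h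
  push_cast
  norm_num
  linarith

/-- The conjugate quadrature mirror conditions satisfied by a squared gain function. -/
structure IsSquaredGain (g : ℝ → ℝ) : Prop where
  continuous : Continuous g
  nonneg : ∀ x, 0 ≤ g x
  add_shift : ∀ x, g x + g (x + Real.pi) = 2

theorem IsSquaredGain.le_two {g : ℝ → ℝ} (h : IsSquaredGain g) (x : ℝ) : g x ≤ 2 := by
  have := h.add_shift x
  have := h.nonneg (x + Real.pi)
  linarith

theorem IsSquaredGain.periodic {g : ℝ → ℝ} (h : IsSquaredGain g) :
    Function.Periodic g (2 * Real.pi) := by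
  intro x
  have h1 := h.add_shift x
  have h2 := h.add_shift (x + Real.pi)
  rw [add_assoc, ← two_mul] at h2
  linarith

theorem isSquaredGain_one : IsSquaredGain fun _ => 1 :=
  ⟨continuous_const, fun _ => zero_le_one, fun _ => one_add_one_eq_two⟩

theorem HLfn_nonneg {L : ℕ} (hL : Even L) (l : ℝ) : 0 ≤ HLfn L l := by
  unfold HLfn
  have h1 : 0 ≤ Real.sin (l / 2) ^ L := hL.pow_nonneg _
  have h2 : 0 ≤ ∑ p ∈ Finset.range (L / 2),
      ((L / 2 - 1 + p).choose p : ℝ) * (Real.cos (l / 2)) ^ (2 * p) :=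
    Finset.sum_nonneg fun p _ =>
      mul_nonneg (Nat.cast_nonneg _) ((even_two_mul p).pow_nonneg _)
  positivity

theorem isSquaredGain_HLfn {L : ℕ} (hL : Even L) (hpos : 0 < L) : IsSquaredGain (HLfn L) := by
  have hd := hasDerivAt_HLfn hL hpos
  refine ⟨continuous_iff_continuousAt.2 fun x => (hd x).continuousAt, HLfn_nonneg hL, fun x => ?_⟩
  have hodd : Odd (L - 1) := Nat.Even.sub_odd hpos hL odd_one
  have hconst : ∀ x, HasDerivAt (fun x => HLfn L x + HLfn L (x + Real.pi)) 0 x := by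
    intro x
    convert! (hd x).add ((hd (x + Real.pi)).comp_add_const x Real.pi) using 1
    rw [Real.sin_add_pi, hodd.neg_pow]; ring
  have h0 := is_const_of_deriv_eq_zero (fun x => (hconst x).differentiableAt)
    (fun x => (hconst x).deriv) x 0
  rw [h0]
  obtain ⟨m, hm⟩ := hL
  obtain ⟨n, hn⟩ : ∃ n, m = n + 1 := ⟨m - 1, by omega⟩
  have e1 : L / 2 = n + 1 := by omega
  simp [HLfn, e1, hpos.ne', Finset.sum_range_succ']

theorem isSquaredGain_GLfn {L : ℕ} (hL : Even L) (hpos : 0 < L) : IsSquaredGain (GLfn L) := by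
  have h := isSquaredGain_HLfn hL hpos
  refine ⟨h.continuous.comp (by fun_prop), fun x => h.nonneg _, fun x => ?_⟩
  have := h.add_shift (x - Real.pi)
  simp only [GLfn]
  rw [add_sub_cancel_right, add_comm]
  rwa [sub_add_cancel, add_comm] at this

theorem hasDerivAt_GLfn {L : ℕ} (hL : Even L) (hpos : 0 < L) (l : ℝ) :
    HasDerivAt (GLfn L) (cL L * Real.sin (l - Real.pi) ^ (L - 1)) l :=
  (hasDerivAt_HLfn hL hpos (l - Real.pi)).comp_sub_const l Real.pi

theorem continuous_prod_dilate {g : ℕ → ℝ → ℝ} (hg : ∀ k, Continuous (g k)) (s : Finset ℕ) :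
    Continuous fun x : ℝ => ∏ k ∈ s, g k (2 ^ k * x) :=
  continuous_finsetProd _ fun k _ => (hg k).comp (by fun_prop)

open intervalIntegral in
theorem integral_prod_dilate (n : ℕ) (g : ℕ → ℝ → ℝ) (hg : ∀ k, IsSquaredGain (g k)) :
    ∫ x in (0 : ℝ)..(2 * Real.pi), ∏ k ∈ Finset.range n, g k (2 ^ k * x) = 2 * Real.pi := by
  induction n generalizing g with
  | zero => simp
  | succ n ih =>
    set Q : ℝ → ℝ := fun x => ∏ k ∈ Finset.range n, g (k + 1) (2 ^ k * x) with hQ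
    have hQc : Continuous Q := continuous_prod_dilate (fun k => (hg (k + 1)).continuous) _
    have hQp : ∀ x, Q (2 * (x + Real.pi)) = Q (2 * x) := by
      intro x
      refine Finset.prod_congr rfl fun k _ => ?_
      have := (hg (k + 1)).periodic.nat_mul (2 ^ k) (2 ^ k * (2 * x))
      rw [← this]
      push_cast
      ring_nf
    have hc : Continuous fun x => g 0 x * Q (2 * x) :=
      (hg 0).continuous.mul (hQc.comp (by fun_prop))
    have hc' : Continuous fun x => g 0 (x + Real.pi) * Q (2 * x) :=
      ((hg 0).continuous.comp (by fun_prop)).mul (hQc.comp (by fun_prop))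
    have e : ∀ x : ℝ, ∏ k ∈ Finset.range (n + 1), g k (2 ^ k * x) = g 0 x * Q (2 * x) := by
      intro x
      rw [Finset.prod_range_succ', mul_comm]
      simp only [hQ, pow_zero, one_mul, pow_succ, mul_assoc]
    have hshift : ∫ x in Real.pi..(2 * Real.pi), g 0 x * Q (2 * x) =
        ∫ x in (0 : ℝ)..Real.pi, g 0 (x + Real.pi) * Q (2 * x) := by
      have := integral_comp_add_right (fun x => g 0 x * Q (2 * x)) Real.pi (a := 0) (b := Real.pi)
      rw [zero_add, ← two_mul] at this
      rw [← this]
      exact integral_congr fun x _ => by simp only [hQp]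
    simp_rw [e]
    rw [← integral_add_adjacent_intervals (hc.intervalIntegrable 0 Real.pi)
      (hc.intervalIntegrable _ _), hshift,
      ← integral_add (hc.intervalIntegrable _ _) (hc'.intervalIntegrable _ _)]
    simp_rw [← add_mul, (hg 0).add_shift]
    rw [integral_const_mul, integral_comp_mul_left Q two_ne_zero, mul_zero, smul_eq_mul,
      mul_inv_cancel_left₀ two_ne_zero]
    exact ih (fun k => g (k + 1)) fun k => hg (k + 1)

open intervalIntegral in
theorem integral_prod_erase_dilate_le {n i : ℕ} {g : ℕ → ℝ → ℝ} (hg : ∀ k, IsSquaredGain (g k))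
    {b c : ℝ} (hb : 0 ≤ b) (hbc : b ≤ c) (hc : c ≤ 2 * Real.pi) (hi : i ∈ Finset.range n) :
    ∫ x in b..c, ∏ k ∈ (Finset.range n).erase i, g k (2 ^ k * x) ≤ 2 * Real.pi := by
  set g' := Function.update g i fun _ => 1
  have hg' : ∀ k, IsSquaredGain (g' k) := by
    intro k
    by_cases h : k = i
    · subst h; simpa [g'] using isSquaredGain_one
    · simpa [g', h] using hg k
  have e : ∀ x : ℝ, ∏ k ∈ (Finset.range n).erase i, g k (2 ^ k * x) =
      ∏ k ∈ Finset.range n, g' k (2 ^ k * x) := by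
    intro x
    rw [← Finset.mul_prod_erase _ _ hi]
    simp only [g', Function.update_self, one_mul]
    exact Finset.prod_congr rfl fun k hk => by
      rw [Function.update_of_ne (Finset.ne_of_mem_erase hk)]
  simp_rw [e]
  rw [← integral_prod_dilate n g' hg']
  refine integral_mono_interval hb hbc hc
    (.of_forall fun x => Finset.prod_nonneg fun k _ => (hg' k).nonneg _) ?_
  exact (continuous_prod_dilate (fun k => (hg' k).continuous) _).intervalIntegrable _ _

/-- The filter used at scale `k` in the level-`j` wavelet squared gain. -/
def gainFactor (j L k : ℕ) : ℝ → ℝ := if k + 1 = j then HLfn L else GLfn L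

theorem isSquaredGain_gainFactor {L : ℕ} (hL : Even L) (hpos : 0 < L) (j k : ℕ) :
    IsSquaredGain (gainFactor j L k) := by
  unfold gainFactor
  split_ifs
  exacts [isSquaredGain_HLfn hL hpos, isSquaredGain_GLfn hL hpos]

theorem HjL_eq_prod {j : ℕ} (hj : 1 ≤ j) (L : ℕ) (l : ℝ) :
    HjL j L l = ∏ k ∈ Finset.range j, gainFactor j L k (2 ^ k * l) := by
  obtain ⟨n, rfl⟩ : ∃ n, j = n + 1 := ⟨j - 1, by omega⟩
  rw [Finset.prod_range_succ, HjL, Nat.add_sub_cancel, mul_comm]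
  congr 1
  · refine Finset.prod_congr rfl fun k hk => ?_
    have : k ≠ n := (Finset.mem_range.1 hk).ne
    simp [gainFactor, this]
  · simp [gainFactor]

theorem HjL_nonneg {j L : ℕ} (hj : 1 ≤ j) (hL : Even L) (hpos : 0 < L) (l : ℝ) :
    0 ≤ HjL j L l := by
  rw [HjL_eq_prod hj]
  exact Finset.prod_nonneg fun k _ => (isSquaredGain_gainFactor hL hpos j k).nonneg _

theorem HjL_le {j L : ℕ} (hj : 1 ≤ j) (hL : Even L) (hpos : 0 < L) (l : ℝ) :
    HjL j L l ≤ 2 ^ j := by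
  rw [HjL_eq_prod hj]
  refine (Finset.prod_le_prod (fun k _ => (isSquaredGain_gainFactor hL hpos j k).nonneg _)
    fun k _ => (isSquaredGain_gainFactor hL hpos j k).le_two _).trans_eq (by simp)

theorem exists_hasDerivAt_gainFactor {L : ℕ} (hL : Even L) (hpos : 0 < L) (j k : ℕ) :
    ∃ s : ℝ → ℝ, Continuous s ∧ (∀ x, |s x| ≤ 1) ∧
      ∀ x, HasDerivAt (gainFactor j L k) (cL L * s x) x := by
  have hb : ∀ y : ℝ, |Real.sin y ^ (L - 1)| ≤ 1 := fun y => by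
    rw [abs_pow]; exact pow_le_one₀ (abs_nonneg _) (Real.abs_sin_le_one y)
  unfold gainFactor
  split_ifs
  · exact ⟨fun x => Real.sin x ^ (L - 1), by fun_prop, fun x => hb x, hasDerivAt_HLfn hL hpos⟩
  · exact ⟨fun x => Real.sin (x - Real.pi) ^ (L - 1), by fun_prop, fun x => hb _,
      hasDerivAt_GLfn hL hpos⟩

open intervalIntegral in
/-- The total variation of the level-`j` squared gain on a subinterval of `[0, 2 * π]`
is `O(2 ^ j * cL L)`. -/
theorem exists_hasDerivAt_HjL {j L : ℕ} (hj : 1 ≤ j) (hL : Even L) (hpos : 0 < L) :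
    ∃ H' : ℝ → ℝ, Continuous H' ∧ (∀ x, HasDerivAt (HjL j L) (H' x) x) ∧
      ∀ b c : ℝ, 0 ≤ b → b ≤ c → c ≤ 2 * Real.pi →
        ∫ x in b..c, |H' x| ≤ 2 ^ j * cL L * (2 * Real.pi) := by
  have hg := isSquaredGain_gainFactor hL hpos j
  have hcL : 0 ≤ cL L := zero_le_one.trans (one_le_cL hL hpos)
  choose s hsc hs1 hsd using exists_hasDerivAt_gainFactor hL hpos j
  have hpc : ∀ i, Continuous fun x : ℝ =>
      ∏ k ∈ (Finset.range j).erase i, gainFactor j L k (2 ^ k * x) := fun i =>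
    continuous_prod_dilate (fun k => (hg k).continuous) _
  have hH'c : Continuous fun x => ∑ i ∈ Finset.range j,
      (∏ k ∈ (Finset.range j).erase i, gainFactor j L k (2 ^ k * x)) •
        (cL L * s i (2 ^ i * x) * 2 ^ i) := by
    refine continuous_finsetSum _ fun i _ => (hpc i).smul ?_
    exact (continuous_const.mul ((hsc i).comp (by fun_prop))).mul continuous_const
  refine ⟨_, hH'c, fun x => ?_, fun b c hb hbc hc => ?_⟩
  · rw [show HjL j L = _ from funext (HjL_eq_prod hj L)]
    refine HasDerivAt.fun_finsetProd fun i _ => ?_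
    have h2 : HasDerivAt (fun x : ℝ => 2 ^ i * x) (2 ^ i) x := by
      simpa using (hasDerivAt_id x).const_mul ((2 : ℝ) ^ i)
    exact (hsd i (2 ^ i * x)).comp x h2
  · calc _ ≤ ∫ x in b..c, ∑ i ∈ Finset.range j, (cL L * 2 ^ i) *
          ∏ k ∈ (Finset.range j).erase i, gainFactor j L k (2 ^ k * x) := by
          refine integral_mono_on hbc (hH'c.abs.intervalIntegrable _ _)
            ((continuous_finsetSum _ fun i _ =>
              continuous_const.mul (hpc i)).intervalIntegrable _ _) fun x _ => ?_
          refine (Finset.abs_sum_le_sum_abs _ _).trans (Finset.sum_le_sum fun i _ => ?_)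
          have hp : 0 ≤ ∏ k ∈ (Finset.range j).erase i, gainFactor j L k (2 ^ k * x) :=
            Finset.prod_nonneg fun k _ => (hg k).nonneg _
          rw [smul_eq_mul, abs_mul, abs_of_nonneg hp, abs_mul, abs_mul, abs_of_nonneg hcL,
            abs_of_nonneg (by positivity : (0 : ℝ) ≤ 2 ^ i), mul_comm]
          gcongr
          exact mul_le_of_le_one_right hcL (hs1 i _)
      _ = ∑ i ∈ Finset.range j, (cL L * 2 ^ i) * ∫ x in b..c,
          ∏ k ∈ (Finset.range j).erase i, gainFactor j L k (2 ^ k * x) := by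
          rw [integral_finsetSum fun i _ => ((hpc i).intervalIntegrable b c).const_mul _]
          simp_rw [integral_const_mul]
      _ ≤ ∑ i ∈ Finset.range j, (cL L * 2 ^ i) * (2 * Real.pi) := by
          refine Finset.sum_le_sum fun i hi => ?_
          gcongr
          exact integral_prod_erase_dilate_le hg hb hbc hc hi
      _ = ((2 : ℝ) ^ j - 1) * cL L * (2 * Real.pi) := by
          have := geom_sum_eq (by norm_num : (2 : ℝ) ≠ 1) j
          rw [← Finset.sum_mul, ← Finset.mul_sum, this]
          ring
      _ ≤ _ := by
          have := Real.pi_pos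
          gcongr
          linarith

theorem one_sub_mul_cexp_ne_zero {p : ℝ} (hp : p ∈ Set.Ico (0 : ℝ) 1) (x : ℝ) :
    1 - (p : ℂ) * Complex.exp (x * Complex.I) ≠ 0 := by
  intro h
  have h1 : ‖(p : ℂ) * Complex.exp (x * Complex.I)‖ = 1 := by
    rw [← sub_eq_zero.1 h, norm_one]
  rw [norm_mul, Complex.norm_exp_ofReal_mul_I, mul_one, Complex.norm_real, Real.norm_eq_abs,
    abs_of_nonneg hp.1] at h1
  exact hp.2.ne h1

theorem contDiff_Pifn {p1 p2 : ℝ} (hp1 : p1 ∈ Set.Ico (0 : ℝ) 1) (hp2 : p2 ∈ Set.Ico (0 : ℝ) 1) :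
    ContDiff ℝ 1 (Pifn p1 p2) := by
  have hof : ContDiff ℝ 1 (fun x : ℝ => (x : ℂ)) := Complex.ofRealCLM.contDiff
  have hI : ContDiff ℝ 1 (fun x : ℝ => Complex.I * (x : ℂ)) := contDiff_const.mul hof
  unfold Pifn
  have h1 := hI.cexp
  have h2 := hI.neg.cexp
  have hden : ContDiff ℝ 1 fun x : ℝ => (1 - (p1 : ℂ) * Complex.exp (Complex.I * x)) *
      (1 - (p2 : ℂ) * Complex.exp (-(Complex.I * x))) := by fun_prop
  simp_rw [div_eq_mul_inv]
  refine contDiff_const.mul (hden.inv fun x => mul_ne_zero ?_ ?_)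
  · simpa [mul_comm] using one_sub_mul_cexp_ne_zero hp1 x
  · simpa [mul_comm] using one_sub_mul_cexp_ne_zero hp2 (-x)

/-- `Dfn` agrees away from the origin with a continuously differentiable function. -/
theorem exists_contDiff_eq_Dfn :
    ∃ d : ℝ → ℂ, ContDiff ℝ 1 d ∧ ∀ l : ℝ, l ≠ 0 → d l = (Dfn l : ℂ) := by
  have hS : Differentiable ℂ (dslope Complex.sin 0) := by
    rw [← differentiableOn_univ, Complex.differentiableOn_dslope Filter.univ_mem]
    exact Complex.differentiable_sin.differentiableOn
  have hS1 : ContDiff ℝ 1 (dslope Complex.sin 0) := (hS.contDiff (n := 1)).restrict_scalars ℝ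
  have hof : ContDiff ℝ 1 (fun x : ℝ => (x : ℂ) / 2) := Complex.ofRealCLM.contDiff.div_const 2
  refine ⟨fun l => 1 / (2 * Real.pi) * (dslope Complex.sin 0 ((l : ℂ) / 2)) ^ 2,
    contDiff_const.mul ((hS1.comp hof).pow 2), fun l hl => ?_⟩
  have hl' : (l : ℂ) ≠ 0 := Complex.ofReal_ne_zero.2 hl
  have hpi : (Real.pi : ℂ) ≠ 0 := Complex.ofReal_ne_zero.2 Real.pi_ne_zero
  simp only
  rw [dslope_of_ne _ (div_ne_zero hl' two_ne_zero), slope_def_field, Dfn]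
  push_cast
  simp only [Complex.sin_zero, sub_zero]
  field_simp

/-- The product of `Dfn` and `Pifn` extends to a `C¹` function bounded with its derivative. -/
theorem exists_extension_Dfn_mul_Pifn {p1 p2 : ℝ} (hp1 : p1 ∈ Set.Ico (0 : ℝ) 1)
    (hp2 : p2 ∈ Set.Ico (0 : ℝ) 1) :
    ∃ (W W' : ℝ → ℂ) (M : ℝ), 0 < M ∧ Continuous W ∧ Continuous W' ∧
      (∀ x, HasDerivAt W (W' x) x) ∧ (∀ x : ℝ, x ≠ 0 → W x = (Dfn x : ℂ) * Pifn p1 p2 x) ∧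
      (∀ x ∈ Set.Icc 0 Real.pi, ‖W x‖ ≤ M) ∧ ∀ x ∈ Set.Icc 0 Real.pi, ‖W' x‖ ≤ M := by
  obtain ⟨d, hd, hd'⟩ := exists_contDiff_eq_Dfn
  have hW := hd.mul (contDiff_Pifn hp1 hp2)
  have hW' := hW.continuous_deriv le_rfl
  obtain ⟨C1, h1⟩ := isCompact_Icc.exists_bound_of_continuousOn (s := Set.Icc 0 Real.pi)
    hW.continuous.continuousOn
  obtain ⟨C2, h2⟩ := isCompact_Icc.exists_bound_of_continuousOn (s := Set.Icc 0 Real.pi)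
    hW'.continuousOn
  refine ⟨_, _, max 1 (max C1 C2), by positivity, hW.continuous, hW',
    fun x => (hW.differentiable one_ne_zero x).hasDerivAt, fun x hx => by rw [hd' x hx],
    fun x hx => (h1 x hx).trans ?_, fun x hx => (h2 x hx).trans ?_⟩ <;> simp

theorem statement4
    (p1 p2 : ℝ) (hp1 : p1 ∈ Set.Ico (0 : ℝ) 1) (hp2 : p2 ∈ Set.Ico (0 : ℝ) 1) :
    ∃ A : ℝ, 0 < A ∧
      ∀ (i j : ℕ), 1 ≤ i → 1 ≤ j → ∀ L : ℕ, Even L → 0 < L → ∀ a : ℝ, a ≠ 0 →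
        ‖∫ l in (Real.pi / 2 ^ i)..(Real.pi / 2 ^ (i - 1)),
            ((Dfn l : ℝ) : ℂ) * ((HjL j L l : ℝ) : ℂ) * Pifn p1 p2 l *
              Complex.exp (Complex.I * a * l)‖ ≤ 2 ^ j * cL L * A / |a| := by
  obtain ⟨W, W', M, hM, hWc, hW'c, hWd, hWeq, hWb, hW'b⟩ := exists_extension_Dfn_mul_Pifn hp1 hp2
  have hpi := Real.pi_pos
  refine ⟨M * (2 + 3 * Real.pi), by positivity, fun i j _ hj L hL hpos a ha => ?_⟩
  obtain ⟨H', hH'c, hHd, hHint⟩ := exists_hasDerivAt_HjL hj hL hpos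
  have hHc : Continuous (HjL j L) := continuous_iff_continuousAt.2 fun x => (hHd x).continuousAt
  have hc1 := one_le_cL hL hpos
  set b := Real.pi / 2 ^ i with hbdef
  set c := Real.pi / 2 ^ (i - 1) with hcdef
  have hb0 : 0 < b := by positivity
  have hbc : b ≤ c := by
    rw [hbdef, hcdef]
    gcongr
    · norm_num
    · omega
  have hcpi : c ≤ Real.pi := div_le_self hpi.le (one_le_pow₀ one_le_two)
  have hmem : ∀ x ∈ Set.Icc b c, x ∈ Set.Icc 0 Real.pi := fun x hx =>
    ⟨hb0.le.trans hx.1, hx.2.trans hcpi⟩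
  have hHn : ∀ x, ‖((HjL j L x : ℝ) : ℂ)‖ ≤ 2 ^ j := fun x => by
    rw [Complex.norm_real, Real.norm_of_nonneg (HjL_nonneg hj hL hpos x)]
    exact HjL_le hj hL hpos x
  have hF : ∀ x, HasDerivAt (fun x => W x * ((HjL j L x : ℝ) : ℂ))
      (W' x * ((HjL j L x : ℝ) : ℂ) + W x * ((H' x : ℝ) : ℂ)) x := fun x =>
    (hWd x).mul (hHd x).ofReal_comp
  have hF'c : Continuous fun x => W' x * ((HjL j L x : ℝ) : ℂ) + W x * ((H' x : ℝ) : ℂ) := by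
    fun_prop
  have hFb : ∀ x ∈ Set.Icc b c, ‖W x * ((HjL j L x : ℝ) : ℂ)‖ ≤ M * 2 ^ j := fun x hx => by
    rw [norm_mul]
    exact mul_le_mul (hWb x (hmem x hx)) (hHn x) (norm_nonneg _) hM.le
  have hint : ∫ x in b..c, ‖W' x * ((HjL j L x : ℝ) : ℂ) + W x * ((H' x : ℝ) : ℂ)‖ ≤
      M * 2 ^ j * Real.pi + M * (2 ^ j * cL L * (2 * Real.pi)) := by
    calc _ ≤ ∫ x in b..c, (M * 2 ^ j + M * |H' x|) := by
          refine intervalIntegral.integral_mono_on hbc (hF'c.norm.intervalIntegrable _ _)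
            ((continuous_const.add
              (continuous_const.mul hH'c.abs)).intervalIntegrable _ _) fun x hx => ?_
          refine (norm_add_le _ _).trans ?_
          rw [norm_mul, norm_mul, Complex.norm_real (H' x), Real.norm_eq_abs]
          exact add_le_add
            (mul_le_mul (hW'b x (hmem x hx)) (hHn x) (norm_nonneg _) hM.le)
            (mul_le_mul_of_nonneg_right (hWb x (hmem x hx)) (abs_nonneg _))
      _ = (c - b) * (M * 2 ^ j) + M * ∫ x in b..c, |H' x| := by
          rw [intervalIntegral.integral_add (continuous_const.intervalIntegrable _ _)
            ((hH'c.abs.intervalIntegrable b c).const_mul M),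
            intervalIntegral.integral_const, intervalIntegral.integral_const_mul, smul_eq_mul]
      _ ≤ Real.pi * (M * 2 ^ j) + M * (2 ^ j * cL L * (2 * Real.pi)) := by
          gcongr
          · linarith
          · exact hHint b c hb0.le hbc (by linarith)
      _ = _ := by ring
  have hcongr : ∫ l in b..c, ((Dfn l : ℝ) : ℂ) * ((HjL j L l : ℝ) : ℂ) * Pifn p1 p2 l *
        Complex.exp (Complex.I * a * l) =
      ∫ l in b..c, W l * ((HjL j L l : ℝ) : ℂ) * Complex.exp (Complex.I * a * l) := by
    refine intervalIntegral.integral_congr fun x hx => ?_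
    rw [Set.uIcc_of_le hbc] at hx
    simp only [hWeq x (hb0.trans_le hx.1).ne']
    ring
  rw [hcongr]
  refine (norm_integral_mul_cexp_le hbc ha hF hF'c).trans ?_
  gcongr
  calc _ ≤ M * 2 ^ j + M * 2 ^ j +
        (M * 2 ^ j * Real.pi + M * (2 ^ j * cL L * (2 * Real.pi))) :=
        add_le_add (add_le_add (hFb b ⟨le_rfl, hbc⟩) (hFb c ⟨hbc, le_rfl⟩)) hint
    _ = M * 2 ^ j * (2 + Real.pi) * 1 + M * (2 ^ j * cL L * (2 * Real.pi)) := by ring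
    _ ≤ M * 2 ^ j * (2 + Real.pi) * cL L + M * (2 ^ j * cL L * (2 * Real.pi)) := by gcongr
    _ = _ := by ring

end
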